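/- A positive integer m is represented by the quadratic form x^2 + y^2 + 5z^2 (i.e., there exist integers x, y, z with x^2 + y^2 + 5z^2 = m) if and only if m is not of the form 4^k(8ℓ + 3) for some nonnegative integers k and ℓ. -/

import Mathlib

/-- An integer that is a sum of three integer squares. -/
def IsSumThreeSq (n : ℤ) : Prop := ∃ p q r : ℤ, p ^ 2 + q ^ 2 + r ^ 2 = n

/-- The ternary quadratic form with Gram matrix `!![a, f, e; f, b, d; e, d, c]`. -/
def ternaryForm (a b c d e f x y z : ℤ) : ℤ :=
  a * x ^ 2 + b * y ^ 2 + c * z ^ 2 + 2 * d * y * z + 2 * e * x * z + 2 * f * x * y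

lemma exists_abs_two_mul_add_mul_le {a : ℤ} (ha : 0 < a) (f : ℤ) :
    ∃ k : ℤ, |2 * (f + k * a)| ≤ a := by
  refine ⟨-((2 * f + a) / (2 * a)), ?_⟩
  have h1 := Int.emod_add_mul_ediv (2 * f + a) (2 * a)
  have h2 := Int.emod_nonneg (2 * f + a) (by omega : 2 * a ≠ 0)
  have h3 := Int.emod_lt_of_pos (2 * f + a) (by omega : 0 < 2 * a)
  rw [abs_le]
  constructor <;> nlinarith

/-- A reduced positive definite form of determinant one is diagonalised by one shear. -/
lemma isSumThreeSq_of_reduced {a b c d e f : ℤ} (ha : 0 < a) (hΔ : 0 < a * b - f ^ 2)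
    (hdet : a * b * c + 2 * d * e * f - a * d ^ 2 - b * e ^ 2 - c * f ^ 2 = 1)
    (hf : |2 * f| ≤ a) (hg : |2 * (a * d - e * f)| ≤ a * b - f ^ 2)
    (hab : a ≤ b) (hbc : a * b - f ^ 2 ≤ a * c - e ^ 2) (x y z : ℤ) :
    IsSumThreeSq (ternaryForm a b c d e f x y z) := by
  obtain ⟨D, hD⟩ : ∃ D, D = a * b - f ^ 2 := ⟨_, rfl⟩
  obtain ⟨g, hgd⟩ : ∃ g, g = a * d - e * f := ⟨_, rfl⟩
  have hmul : D * (a * c - e ^ 2) - g ^ 2 = a := by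
    rw [hD, hgd]; linear_combination a * hdet
  rw [← hgd, ← hD] at hg
  rw [← hD] at hΔ hbc
  have hf2 : 4 * f ^ 2 ≤ a ^ 2 := by
    have := sq_le_sq' (by linarith [abs_nonneg (2 * f)]) hf
    rw [sq_abs] at this; linarith
  have hg2 : 4 * g ^ 2 ≤ D ^ 2 := by
    have := sq_le_sq' (by linarith [abs_nonneg (2 * g)]) hg
    rw [sq_abs] at this; linarith
  have h1 : 3 * a ^ 2 ≤ 4 * D := by nlinarith
  have h2 : 3 * D ^ 2 ≤ 4 * a := by nlinarith
  have ha1 : a = 1 := by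
    by_contra hne
    have : 2 ≤ a := by omega
    have h3 : 3 * a ≤ 2 * D := by nlinarith
    nlinarith
  subst ha1
  have hD1 : D = 1 := by nlinarith
  have hf0 : f = 0 := by nlinarith
  have hg0 : g = 0 := by subst hD1; nlinarith
  subst hf0
  have hb : b = 1 := by linarith
  have hd : d = 0 := by linarith
  subst hb hd
  have hc : c = 1 + e ^ 2 := by linarith
  subst hc
  exact ⟨x + e * z, y, z, by unfold ternaryForm; ring⟩

/-- Every value of a positive definite integral ternary form of determinant one is a sum of three
squares. -/
theorem isSumThreeSq_ternaryForm (a b c d e f : ℤ) (ha : 0 < a) (hΔ : 0 < a * b - f ^ 2)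
    (hdet : a * b * c + 2 * d * e * f - a * d ^ 2 - b * e ^ 2 - c * f ^ 2 = 1) (x y z : ℤ) :
    IsSumThreeSq (ternaryForm a b c d e f x y z) := by
  obtain ⟨A, hA⟩ : ∃ A : ℕ, a = A := ⟨a.toNat, by omega⟩
  induction A using Nat.strong_induction_on generalizing a b c d e f x y z with
  | _ A ihA =>
  obtain ⟨N, hN⟩ : ∃ N : ℕ, a * b - f ^ 2 = N := ⟨(a * b - f ^ 2).toNat, by omega⟩
  induction N using Nat.strong_induction_on generalizing b c d e f x y z with
  | _ N ihN =>
  obtain ⟨k, hk⟩ := exists_abs_two_mul_add_mul_le ha f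
  obtain ⟨l, hl⟩ := exists_abs_two_mul_add_mul_le hΔ (a * d - e * f)
  obtain ⟨f', hf'⟩ : ∃ t, t = f + k * a := ⟨_, rfl⟩
  obtain ⟨b', hb'⟩ : ∃ t, t = b + 2 * k * f + k ^ 2 * a := ⟨_, rfl⟩
  obtain ⟨d', hd'⟩ : ∃ t, t = d + k * e + l * b' := ⟨_, rfl⟩
  obtain ⟨e', he'⟩ : ∃ t, t = e + l * f' := ⟨_, rfl⟩
  obtain ⟨c', hc'⟩ : ∃ t, t = c + 2 * l * (d + k * e) + l ^ 2 * b' := ⟨_, rfl⟩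
  have hform : ternaryForm a b c d e f x y z =
      ternaryForm a b' c' d' e' f' (x - k * y) (y - l * z) z := by
    unfold ternaryForm; subst hc' he' hd' hb' hf'; ring
  have hΔ' : a * b' - f' ^ 2 = a * b - f ^ 2 := by subst hb' hf'; ring
  have hdet' : a * b' * c' + 2 * d' * e' * f' - a * d' ^ 2 - b' * e' ^ 2 - c' * f' ^ 2 = 1 := by
    rw [← hdet]; subst hc' he' hd' hb' hf'; ring
  have hg' : a * d' - e' * f' = a * d - e * f + l * (a * b - f ^ 2) := by
    subst he' hd' hb' hf'; ring
  rw [← hf'] at hk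
  rw [← hg', ← hΔ'] at hl
  rw [← hΔ'] at hΔ hN
  rw [hform]
  clear hform hΔ' hg' hdet hc' he' hd' hb' hf'
  have hmul : (a * b' - f' ^ 2) * (a * c' - e' ^ 2) = a + (a * d' - e' * f') ^ 2 := by
    linear_combination a * hdet'
  rcases lt_or_ge b' a with hba | hab
  · have hb0 : 0 < b' := by nlinarith
    have := ihA b'.toNat (by omega) b' a c' e' d' f' hb0 (by linarith) (by linarith)
      (y - l * z) (x - k * y) z (by omega)
    convert this using 1
    unfold ternaryForm; ring
  rcases lt_or_ge (a * c' - e' ^ 2) (a * b' - f' ^ 2) with hcb | hbc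
  · have hc0 : 0 < a * c' - e' ^ 2 := by
      by_contra h
      nlinarith [sq_nonneg (a * d' - e' * f')]
    have := ihN (a * c' - e' ^ 2).toNat (by omega) c' b' d' f' e' hc0 (by linarith)
      (x - k * y) z (y - l * z) (by omega)
    convert this using 1
    unfold ternaryForm; ring
  exact isSumThreeSq_of_reduced ha hΔ hdet' hk hl hab hbc _ _ _

/-- Dirichlet's criterion for sums of three squares. -/
lemma isSumThreeSq_of_dvd {n b t : ℤ} (hb : 0 < b) (hn : 0 < b * n - 1)
    (h : b * n - 1 ∣ t ^ 2 + b) : IsSumThreeSq n := by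
  obtain ⟨a, ha⟩ := h
  have ha0 : 0 < a := by
    by_contra h0
    nlinarith [sq_nonneg t]
  have := isSumThreeSq_ternaryForm a (b * n - 1) n 0 1 t ha0 (by linarith)
    (by linear_combination (-n) * ha) 0 0 1
  simpa [ternaryForm] using this

lemma exists_dvd_sq_add_of_jacobiSym {p : ℕ} [Fact p.Prime] {b : ℤ}
    (h : jacobiSym (-b) p = 1) : ∃ t : ℤ, (p : ℤ) ∣ t ^ 2 + b := by
  obtain ⟨r, hr⟩ := ZMod.isSquare_of_jacobiSym_eq_one h
  obtain ⟨t, rfl⟩ := ZMod.intCast_surjective r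
  refine ⟨t, (ZMod.intCast_zmod_eq_zero_iff_dvd _ _).mp ?_⟩
  push_cast at hr ⊢
  rw [pow_two, ← hr]; ring

lemma exists_prime_eq_add_mul {q n : ℕ} (hn : 0 < n) (hq : Odd q) {u v : ℤ}
    (huv : u * q + v * n = 1) : ∃ p j : ℕ, p.Prime ∧ p = q + 4 * (n * j) := by
  have hcop : q.Coprime (4 * n) := by
    refine Nat.Coprime.mul_right ?_ (Nat.isCoprime_iff_coprime.mp ⟨u, v, huv⟩)
    exact Nat.Coprime.pow_right 2 (Nat.coprime_two_right.mpr hq)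
  obtain ⟨p, hpq, hp, hmod⟩ := Nat.forall_exists_prime_gt_and_modEq q (by omega) hcop
  obtain ⟨j, hj⟩ := (Nat.modEq_iff_dvd' hpq.le).mp hmod.symm
  exact ⟨p, j, hp, by rw [← mul_assoc]; omega⟩

lemma jacobiSym_neg_eq_swap {b p : ℕ} (hb : Odd b) (hp : Odd p)
    (h : p % 4 = 1 ∨ b % 4 = 3 ∧ p % 4 = 3) : jacobiSym (-b) p = jacobiSym p b := by
  rw [jacobiSym.neg _ hp]
  rcases h with h | ⟨h, h'⟩
  · rw [ZMod.χ₄_nat_one_mod_four h, one_mul, jacobiSym.quadratic_reciprocity_one_mod_four' hb h]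
  · rw [ZMod.χ₄_nat_three_mod_four h', jacobiSym.quadratic_reciprocity_three_mod_four h h']
    ring

lemma jacobiSym_eq_of_dvd_sub {a a' : ℤ} {b : ℕ} (h : (b : ℤ) ∣ a - a') :
    jacobiSym a b = jacobiSym a' b :=
  jacobiSym.mod_left' (Int.emod_eq_emod_iff_emod_sub_eq_zero.mpr (Int.emod_eq_zero_of_dvd h))

lemma isSumThreeSq_of_mod_four_eq_two {n : ℕ} (hn : n % 4 = 2) : IsSumThreeSq n := by
  obtain ⟨q, rfl⟩ : ∃ q, n = q + 1 := ⟨n - 1, by omega⟩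
  obtain ⟨p, j, hp, hpj⟩ := exists_prime_eq_add_mul (q := q) (n := q + 1) (u := -1) (v := 1)
    (by omega) (Nat.odd_iff.mpr (by omega)) (by push_cast; ring)
  have := Fact.mk hp
  obtain ⟨b, hb⟩ : ∃ b, b = 4 * j + 1 := ⟨_, rfl⟩
  have hpb : (b * (q + 1 : ℕ) - 1 : ℤ) = p := by rw [hb, hpj]; push_cast; ring
  have hp4 : p % 4 = 1 := by omega
  have hbodd : Odd b := Nat.odd_iff.mpr (by omega)
  have hJ : jacobiSym (-b) p = 1 := by
    rw [jacobiSym_neg_eq_swap hbodd (Nat.odd_iff.mpr (by omega)) (.inl hp4),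
      jacobiSym_eq_of_dvd_sub (a' := -1) ⟨(q + 1 : ℕ), by linarith⟩,
      jacobiSym.at_neg_one hbodd, ZMod.χ₄_nat_one_mod_four (by omega)]
  obtain ⟨t, ht⟩ := exists_dvd_sq_add_of_jacobiSym hJ
  rw [← hpb] at ht
  exact isSumThreeSq_of_dvd (by omega) (by rw [hpb]; exact_mod_cast hp.pos) ht

/-- The odd case, with a prime `p` such that `2 * p = b * n - 1`, where `b ≡ c` modulo `8`. -/
lemma isSumThreeSq_of_mul_eq {n c q : ℕ} (hcq : c * n = 2 * q + 1) (hc : c % 8 = 1 ∨ c % 8 = 3)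
    (hq : q % 4 = 1 ∨ c % 4 = 3 ∧ q % 4 = 3) : IsSumThreeSq n := by
  have hn : 0 < n := Nat.pos_of_ne_zero (by rintro rfl; omega)
  obtain ⟨p, j, hp, hpj⟩ := exists_prime_eq_add_mul (q := q) (n := n) (u := -2) (v := c)
    hn (Nat.odd_iff.mpr (by omega)) (by zify at hcq; linarith)
  have := Fact.mk hp
  obtain ⟨b, hb⟩ : ∃ b, b = 8 * j + c := ⟨_, rfl⟩
  have hpb : (b * n - 1 : ℤ) = 2 * p := by
    zify at hcq
    rw [hb, hpj]; push_cast; linear_combination hcq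
  have hbodd : Odd b := Nat.odd_iff.mpr (by omega)
  have hJ : jacobiSym (-b) p = 1 := by
    have h2 : jacobiSym (-2) b = 1 := by
      rw [jacobiSym.at_neg_two hbodd, ZMod.χ₈'_nat_eq_if_mod_eight]
      rw [if_neg (by omega), if_pos (by omega)]
    rw [jacobiSym_neg_eq_swap hbodd (Nat.odd_iff.mpr (by omega)) (by omega),
      ← one_mul (jacobiSym p b), ← h2, ← jacobiSym.mul_left,
      jacobiSym_eq_of_dvd_sub (a' := 1) ⟨-n, by linarith⟩, jacobiSym.one_left, h2]
  obtain ⟨t, ht⟩ := exists_dvd_sq_add_of_jacobiSym hJ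
  have hp2 : (p : ℤ) % 2 = 1 := by omega
  have hb2 : (b : ℤ) % 2 = 1 := by omega
  obtain ⟨s, hs, hs2⟩ : ∃ s : ℤ, (p : ℤ) ∣ s ^ 2 + b ∧ s % 2 = 1 := by
    rcases Int.emod_two_eq_zero_or_one t with h | h
    · refine ⟨t + p, ?_, by omega⟩
      have : (t + p) ^ 2 + b = (t ^ 2 + b) + p * (2 * t + p) := by ring
      rw [this]
      exact dvd_add ht (dvd_mul_right _ _)
    · exact ⟨t, ht, h⟩
  have hdvd2 : (2 : ℤ) ∣ s ^ 2 + b := by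
    have : (s ^ 2) % 2 = 1 := by rw [pow_two, Int.mul_emod, hs2]; rfl
    omega
  have hcop : IsCoprime (2 : ℤ) p := ⟨-(p / 2), 1, by omega⟩
  refine isSumThreeSq_of_dvd (b := b) (t := s) (by omega) ?_ ?_
  · rw [hpb]; have := hp.pos; omega
  · rw [hpb]; exact hcop.mul_dvd hdvd2 hs

/-- **Legendre's three-square theorem** (the existence part). -/
theorem isSumThreeSq_of_forall_ne (n : ℕ) (hn : ∀ k l : ℕ, n ≠ 4 ^ k * (8 * l + 7)) :
    IsSumThreeSq n := by
  induction n using Nat.strong_induction_on with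
  | _ n ih =>
  have h7 : n % 8 ≠ 7 := fun h => hn 0 (n / 8) (by omega)
  rcases Nat.eq_zero_or_pos n with rfl | hpos
  · exact ⟨0, 0, 0, by norm_num⟩
  by_cases h0 : n % 4 = 0
  · obtain ⟨a, rfl⟩ := Nat.dvd_of_mod_eq_zero h0
    obtain ⟨x, y, z, h⟩ := ih a (by omega) fun k l h => hn (k + 1) l (by rw [h]; ring)
    exact ⟨2 * x, 2 * y, 2 * z, by push_cast; linear_combination 4 * h⟩
  by_cases h2 : n % 4 = 2
  · exact isSumThreeSq_of_mod_four_eq_two h2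
  by_cases h3 : n % 8 = 3
  · exact isSumThreeSq_of_mul_eq (c := 1) (q := n / 2) (by omega) (by omega) (by omega)
  · exact isSumThreeSq_of_mul_eq (c := 3) (q := 3 * n / 2) (by omega) (by omega) (by omega)

lemma sq_emod_five (x : ℤ) : x ^ 2 % 5 = 0 ∧ x % 5 = 0 ∨
    x ^ 2 % 5 = 1 ∧ (x % 5 = 1 ∨ x % 5 = 4) ∨ x ^ 2 % 5 = 4 ∧ (x % 5 = 2 ∨ x % 5 = 3) := by
  have h : x % 5 = 0 ∨ x % 5 = 1 ∨ x % 5 = 2 ∨ x % 5 = 3 ∨ x % 5 = 4 := by omega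
  rcases h with h | h | h | h | h <;> simp [pow_two, Int.mul_emod, h]

lemma exists_rep_of_five_dvd {m x y z : ℤ} (h : x ^ 2 + y ^ 2 + z ^ 2 = 5 * m) (hz : z % 5 = 0) :
    ∃ x y z : ℤ, x ^ 2 + y ^ 2 + 5 * z ^ 2 = m := by
  obtain ⟨w, rfl⟩ := Int.dvd_of_emod_eq_zero hz
  have key (y : ℤ) (hy : x ^ 2 + y ^ 2 + (5 * w) ^ 2 = 5 * m) (hxy : (x - 2 * y) % 5 = 0) :
      ∃ x y z : ℤ, x ^ 2 + y ^ 2 + 5 * z ^ 2 = m := by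
    obtain ⟨v, hv⟩ := Int.dvd_of_emod_eq_zero hxy
    obtain rfl : x = 5 * v + 2 * y := by linarith
    exact ⟨2 * v + y, v, w, by linarith⟩
  have hw : (5 * w) ^ 2 = 5 * (5 * w ^ 2) := by ring
  have : (x - 2 * y) % 5 = 0 ∨ (x - 2 * -y) % 5 = 0 := by
    rcases sq_emod_five x with hx | hx | hx <;> rcases sq_emod_five y with hy | hy | hy <;> omega
  rcases this with h' | h'
  · exact key y h h'
  · exact key (-y) (by rwa [neg_sq]) h'

/-- A sum of three squares divisible by `5` has a term divisible by `5`. -/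
lemma exists_rep_of_isSumThreeSq {m : ℤ} (h : IsSumThreeSq (5 * m)) :
    ∃ x y z : ℤ, x ^ 2 + y ^ 2 + 5 * z ^ 2 = m := by
  obtain ⟨x, y, z, h⟩ := h
  have : x % 5 = 0 ∨ y % 5 = 0 ∨ z % 5 = 0 := by
    rcases sq_emod_five x with hx | hx | hx <;> rcases sq_emod_five y with hy | hy | hy <;>
      rcases sq_emod_five z with hz | hz | hz <;> omega
  rcases this with h' | h' | h'
  · exact exists_rep_of_five_dvd (x := y) (y := z) (by linarith) h'
  · exact exists_rep_of_five_dvd (x := x) (y := z) (by linarith) h'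
  · exact exists_rep_of_five_dvd h h'

lemma sq_emod_eight (x : ℤ) :
    x ^ 2 % 8 = 0 ∧ x % 2 = 0 ∨ x ^ 2 % 8 = 1 ∧ x % 2 = 1 ∨ x ^ 2 % 8 = 4 ∧ x % 2 = 0 := by
  have h : x % 8 = 0 ∨ x % 8 = 1 ∨ x % 8 = 2 ∨ x % 8 = 3 ∨ x % 8 = 4 ∨ x % 8 = 5 ∨ x % 8 = 6 ∨
    x % 8 = 7 := by omega
  have h2 : x % 2 = x % 8 % 2 := by omega
  rcases h with h | h | h | h | h | h | h | h <;> simp [pow_two, Int.mul_emod, h, h2]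

lemma sq_add_sq_add_five_mul_sq_ne (k : ℕ) (l x y z : ℤ) :
    x ^ 2 + y ^ 2 + 5 * z ^ 2 ≠ 4 ^ k * (8 * l + 3) := by
  induction k generalizing x y z with
  | zero =>
    intro h
    rcases sq_emod_eight x with hx | hx | hx <;> rcases sq_emod_eight y with hy | hy | hy <;>
      rcases sq_emod_eight z with hz | hz | hz <;> omega
  | succ k ih =>
    intro h
    rw [pow_succ 4, mul_comm _ (4 : ℤ), mul_assoc] at h
    have : x % 2 = 0 ∧ y % 2 = 0 ∧ z % 2 = 0 := by
      rcases sq_emod_eight x with hx | hx | hx <;> rcases sq_emod_eight y with hy | hy | hy <;>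
        rcases sq_emod_eight z with hz | hz | hz <;> omega
    obtain ⟨hx, hy, hz⟩ := this
    obtain ⟨x, rfl⟩ := Int.dvd_of_emod_eq_zero hx
    obtain ⟨y, rfl⟩ := Int.dvd_of_emod_eq_zero hy
    obtain ⟨z, rfl⟩ := Int.dvd_of_emod_eq_zero hz
    exact ih x y z (by linarith)

theorem rep_x2_y2_5z2 (m : ℤ) (hm : 0 < m) :
    (∃ x y z : ℤ, x ^ 2 + y ^ 2 + 5 * z ^ 2 = m) ↔
      ¬ ∃ k l : ℕ, m = 4 ^ k * (8 * l + 3) := by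
  constructor
  · rintro ⟨x, y, z, h⟩ ⟨k, l, rfl⟩
    exact sq_add_sq_add_five_mul_sq_ne k l x y z h
  · intro h
    lift m to ℕ using hm.le
    have hsum := isSumThreeSq_of_forall_ne (5 * m) fun k l hkl => h <| by
      have hdvd : 5 ∣ 8 * l + 7 :=
        (Nat.Coprime.pow_right k (by norm_num : Nat.Coprime 5 4)).dvd_of_dvd_mul_left ⟨m, hkl.symm⟩
      obtain ⟨r, hr⟩ : ∃ r, 8 * l + 7 = 5 * (8 * r + 3) := ⟨(l - 1) / 5, by omega⟩
      refine ⟨k, r, ?_⟩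
      rw [hr] at hkl
      zify at hkl
      linarith
    push_cast at hsum
    exact exists_rep_of_isSumThreeSq hsum
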